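/- arXiv:2101.06907 — 2 statements merged into one kernel-verified Lean document; each statement's English description precedes it below -/
import Mathlib

section
/- Let μ = N(0,1)^{⊗m} be the product of m standard Gaussian measures on ℝ^m, let P be a real multivariate polynomial in m variables of total degree at most 4, let ρ ∈ (0,1), and let a₀ > 0 satisfy a₀ ≥ c(ρ) · (∫_{ℝ^m} P(ξ)² dμ(ξ))^{1/2}. Then μ({ξ ∈ ℝ^m : P(ξ) ≥ a₀}) ≤ ρ. -/
open MeasureTheory ProbabilityTheory

/-- The exponent `q(ρ)` from the paper's Theorem 1. -/
noncomputable def qFun (ρ : ℝ) : ℝ :=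
  if ρ ∈ Set.Ioc (0 : ℝ) (Real.exp (-8)) then
    (-Real.log ρ + Real.sqrt ((Real.log ρ) ^ 2 - 8 * Real.log ρ)) / 4
  else 2

/-- The constant `c(ρ)` from the paper's Theorem 1:
`c(ρ) = (q(ρ)-1)² exp(2 q(ρ)/(q(ρ)-1))` if `q(ρ) > 2`, and `c(ρ) = 1/√ρ` if `q(ρ) = 2`. -/
noncomputable def cFun (ρ : ℝ) : ℝ :=
  if 2 < qFun ρ then (qFun ρ - 1) ^ 2 * Real.exp (2 * qFun ρ / (qFun ρ - 1))
  else 1 / Real.sqrt ρ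

/-- The mean of a function on the discrete cube `{±1}ⁿ`. -/
noncomputable def cubeMean {n : ℕ} (f : (Fin n → Bool) → ℝ) : ℝ := (∑ x, f x) / 2 ^ n

/-- The value `±1` of a bit. -/
def bitSign (b : Bool) : ℝ := if b then 1 else -1

/-- The part of a function on the cube that is even in the first coordinate. -/
noncomputable def evenPart (n : ℕ) : ((Fin (n + 1) → Bool) → ℝ) →ₗ[ℝ] ((Fin n → Bool) → ℝ) where
  toFun f x := (f (Fin.cons true x) + f (Fin.cons false x)) / 2
  map_add' f g := by ext x; simp only [Pi.add_apply]; ring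
  map_smul' c f := by ext x; simp only [Pi.smul_apply, smul_eq_mul, RingHom.id_apply]; ring

/-- The coefficient of the first coordinate in a function on the cube. -/
noncomputable def oddPart (n : ℕ) : ((Fin (n + 1) → Bool) → ℝ) →ₗ[ℝ] ((Fin n → Bool) → ℝ) where
  toFun f x := (f (Fin.cons true x) - f (Fin.cons false x)) / 2
  map_add' f g := by ext x; simp only [Pi.add_apply]; ring
  map_smul' c f := by ext x; simp only [Pi.smul_apply, smul_eq_mul, RingHom.id_apply]; ring

/-- The functions on the discrete cube that are polynomials of degree less than `d`. -/
noncomputable def cubeDegreeLT : (n d : ℕ) → Submodule ℝ ((Fin n → Bool) → ℝ)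
  | 0, 0 => ⊥
  | 0, _ + 1 => ⊤
  | n + 1, d => (cubeDegreeLT n d).comap (evenPart n) ⊓ (cubeDegreeLT n (d - 1)).comap (oddPart n)

lemma mem_cubeDegreeLT_succ {n d : ℕ} {f : (Fin (n + 1) → Bool) → ℝ} :
    f ∈ cubeDegreeLT (n + 1) d ↔
      evenPart n f ∈ cubeDegreeLT n d ∧ oddPart n f ∈ cubeDegreeLT n (d - 1) :=
  Iff.rfl

lemma eval_cons_true {n : ℕ} (f : (Fin (n + 1) → Bool) → ℝ) (x : Fin n → Bool) :
    f (Fin.cons true x) = evenPart n f x + oddPart n f x := by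
  simp only [evenPart, oddPart, LinearMap.coe_mk, AddHom.coe_mk]; ring

lemma eval_cons_false {n : ℕ} (f : (Fin (n + 1) → Bool) → ℝ) (x : Fin n → Bool) :
    f (Fin.cons false x) = evenPart n f x - oddPart n f x := by
  simp only [evenPart, oddPart, LinearMap.coe_mk, AddHom.coe_mk]; ring

lemma eq_zero_of_mem_cubeDegreeLT_zero : ∀ {n : ℕ} {f : (Fin n → Bool) → ℝ},
    f ∈ cubeDegreeLT n 0 → f = 0
  | 0, f, h => by simpa [cubeDegreeLT] using h
  | n + 1, f, h => by
    rw [mem_cubeDegreeLT_succ] at h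
    have h0 := eq_zero_of_mem_cubeDegreeLT_zero h.1
    have h1 := eq_zero_of_mem_cubeDegreeLT_zero h.2
    ext x
    rw [← Fin.cons_self_tail x]
    cases x 0
    · simp [eval_cons_false, h0, h1]
    · simp [eval_cons_true, h0, h1]

lemma cubeDegreeLT_mono : ∀ {n a b : ℕ}, a ≤ b → cubeDegreeLT n a ≤ cubeDegreeLT n b
  | 0, 0, _, _ => by simp [cubeDegreeLT]
  | 0, a + 1, 0, h => by omega
  | 0, a + 1, b + 1, _ => by simp [cubeDegreeLT]
  | n + 1, a, b, h => fun f hf => by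
    rw [mem_cubeDegreeLT_succ] at hf ⊢
    exact ⟨cubeDegreeLT_mono h hf.1, cubeDegreeLT_mono (by omega) hf.2⟩

lemma const_mem_cubeDegreeLT (c : ℝ) : ∀ n : ℕ, (fun _ => c) ∈ cubeDegreeLT n 1
  | 0 => by simp [cubeDegreeLT]
  | n + 1 => by
    rw [mem_cubeDegreeLT_succ]
    constructor
    · convert const_mem_cubeDegreeLT c n using 1
      ext x; simp [evenPart]
    · convert Submodule.zero_mem _ using 1
      ext x; simp [oddPart]

lemma bitSign_mem_cubeDegreeLT : ∀ {n : ℕ} (i : Fin n),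
    (fun x : Fin n → Bool => bitSign (x i)) ∈ cubeDegreeLT n 2
  | n + 1, i => by
    rw [mem_cubeDegreeLT_succ]
    induction i using Fin.cases with
    | zero =>
      constructor
      · convert Submodule.zero_mem _ using 1
        ext x; simp [evenPart, bitSign]
      · convert const_mem_cubeDegreeLT 1 n using 1
        ext x; simp [oddPart, bitSign]
    | succ i =>
      constructor
      · convert bitSign_mem_cubeDegreeLT i using 1
        ext x; simp [evenPart]
      · convert Submodule.zero_mem _ using 1
        ext x; simp [oddPart]

lemma mul_mem_cubeDegreeLT : ∀ {n a b : ℕ} {f g : (Fin n → Bool) → ℝ},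
    f ∈ cubeDegreeLT n (a + 1) → g ∈ cubeDegreeLT n (b + 1) →
      f * g ∈ cubeDegreeLT n (a + b + 1)
  | 0, _, _, _, _, _, _ => by simp [cubeDegreeLT]
  | n + 1, a, b, f, g, hf, hg => by
    rw [mem_cubeDegreeLT_succ] at hf hg ⊢
    simp only [Nat.add_sub_cancel] at hf hg ⊢
    have he : evenPart n (f * g) = evenPart n f * evenPart n g + oddPart n f * oddPart n g := by
      ext x; simp only [evenPart, oddPart, LinearMap.coe_mk, AddHom.coe_mk, Pi.mul_apply,
        Pi.add_apply]; ring
    have ho : oddPart n (f * g) = evenPart n f * oddPart n g + oddPart n f * evenPart n g := by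
      ext x; simp only [evenPart, oddPart, LinearMap.coe_mk, AddHom.coe_mk, Pi.mul_apply,
        Pi.add_apply]; ring
    rw [he, ho]
    refine ⟨Submodule.add_mem _ (mul_mem_cubeDegreeLT hf.1 hg.1) ?_, Submodule.add_mem _ ?_ ?_⟩
    · exact mul_mem_cubeDegreeLT (cubeDegreeLT_mono (by omega) hf.2)
        (cubeDegreeLT_mono (by omega) hg.2)
    · rcases b with _ | b
      · simp [eq_zero_of_mem_cubeDegreeLT_zero hg.2]
      · exact mul_mem_cubeDegreeLT hf.1 hg.2
    · rcases a with _ | a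
      · simp [eq_zero_of_mem_cubeDegreeLT_zero hf.2]
      · exact cubeDegreeLT_mono (by omega) (mul_mem_cubeDegreeLT hf.2 hg.1)

lemma pow_mem_cubeDegreeLT {n : ℕ} {f : (Fin n → Bool) → ℝ} (hf : f ∈ cubeDegreeLT n 2) (a : ℕ) :
    f ^ a ∈ cubeDegreeLT n (a + 1) := by
  induction a with
  | zero => exact const_mem_cubeDegreeLT 1 n
  | succ a ih => rw [pow_succ]; exact mul_mem_cubeDegreeLT ih hf

lemma prod_mem_cubeDegreeLT {ι : Type*} {n : ℕ} (s : Finset ι) {f : ι → (Fin n → Bool) → ℝ}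
    {a : ι → ℕ} (hf : ∀ i, f i ∈ cubeDegreeLT n (a i + 1)) :
    ∏ i ∈ s, f i ∈ cubeDegreeLT n (∑ i ∈ s, a i + 1) := by
  classical
  induction s using Finset.induction_on with
  | empty => exact const_mem_cubeDegreeLT 1 n
  | insert i s hi ih =>
    rw [Finset.prod_insert hi, Finset.sum_insert hi]
    exact mul_mem_cubeDegreeLT (hf i) ih

lemma eval_mem_cubeDegreeLT {m n d : ℕ} {P : MvPolynomial (Fin m) ℝ} (hP : P.totalDegree ≤ d)
    {S : Fin m → (Fin n → Bool) → ℝ} (hS : ∀ i, S i ∈ cubeDegreeLT n 2) :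
    (fun x => MvPolynomial.eval (fun i => S i x) P) ∈ cubeDegreeLT n (d + 1) := by
  have h : (fun x => MvPolynomial.eval (fun i => S i x) P) =
      ∑ s ∈ P.support, P.coeff s • ∏ i, S i ^ s i := by
    ext x
    simp [MvPolynomial.eval_eq', Finset.sum_apply, Finset.prod_apply]
  rw [h]
  refine Submodule.sum_mem _ fun s hs => Submodule.smul_mem _ _ ?_
  refine cubeDegreeLT_mono ?_ (prod_mem_cubeDegreeLT _ fun i => pow_mem_cubeDegreeLT (hS i) (s i))
  have := MvPolynomial.le_totalDegree hs
  rw [Finsupp.sum_fintype _ _ (by simp)] at this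
  omega

lemma cubeMean_succ {n : ℕ} (f : (Fin (n + 1) → Bool) → ℝ) :
    cubeMean f =
      (cubeMean (fun x => f (Fin.cons true x)) + cubeMean fun x => f (Fin.cons false x)) / 2 := by
  have h : ∑ x, f x = ∑ x, f (Fin.cons true x) + ∑ x, f (Fin.cons false x) := by
    rw [← (Fin.consEquiv fun _ => Bool).sum_comp, Fintype.sum_prod_type]
    simp [Fin.consEquiv]
  simp only [cubeMean, h, pow_succ]
  field_simp

lemma cubeMean_mono {n : ℕ} {f g : (Fin n → Bool) → ℝ} (h : ∀ x, f x ≤ g x) :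
    cubeMean f ≤ cubeMean g :=
  div_le_div_of_nonneg_right (Finset.sum_le_sum fun x _ => h x) (by positivity)

lemma cubeMean_nonneg {n : ℕ} {f : (Fin n → Bool) → ℝ} (h : ∀ x, 0 ≤ f x) : 0 ≤ cubeMean f :=
  div_nonneg (Finset.sum_nonneg fun x _ => h x) (by positivity)

lemma cubeMean_add {n : ℕ} (f g : (Fin n → Bool) → ℝ) :
    cubeMean (fun x => f x + g x) = cubeMean f + cubeMean g := by
  simp [cubeMean, Finset.sum_add_distrib, add_div]

lemma cubeMean_const_mul {n : ℕ} (c : ℝ) (f : (Fin n → Bool) → ℝ) :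
    cubeMean (fun x => c * f x) = c * cubeMean f := by
  simp [cubeMean, ← Finset.mul_sum, mul_div_assoc]

/-- Minkowski's inequality on the cube, for natural exponents. -/
lemma cubeMean_add_pow_le {n k : ℕ} (hk : 1 ≤ k) {u v : (Fin n → Bool) → ℝ}
    (hu : ∀ x, 0 ≤ u x) (hv : ∀ x, 0 ≤ v x) {A B : ℝ} (hA : 0 ≤ A) (hB : 0 ≤ B)
    (hAu : cubeMean (fun x => u x ^ k) ≤ A ^ k) (hBv : cubeMean (fun x => v x ^ k) ≤ B ^ k) :
    cubeMean (fun x => (u x + v x) ^ k) ≤ (A + B) ^ k := by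
  have hk0 : k ≠ 0 := by omega
  have hM := Real.Lp_add_le_of_nonneg (s := Finset.univ) (f := u) (g := v) (p := k)
    (by exact_mod_cast hk) (fun x _ => hu x) (fun x _ => hv x)
  simp only [Real.rpow_natCast, one_div] at hM
  set c : ℝ := (2 ^ n : ℝ) ^ (k : ℝ)⁻¹ with hc
  have hc0 : 0 ≤ c := by positivity
  have hck : c ^ k = 2 ^ n := Real.rpow_inv_natCast_pow (by positivity) hk0
  have key : ∀ (w : (Fin n → Bool) → ℝ) (D : ℝ), (∀ x, 0 ≤ w x) → 0 ≤ D →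
      cubeMean (fun x => w x ^ k) ≤ D ^ k → (∑ x, w x ^ k) ^ (k : ℝ)⁻¹ ≤ c * D := by
    intro w D hw hD h
    rw [cubeMean, div_le_iff₀ (by positivity), ← hck, ← mul_pow, mul_comm] at h
    refine (Real.rpow_le_rpow (Finset.sum_nonneg fun x _ => pow_nonneg (hw x) k) h
      (by positivity)).trans_eq ?_
    exact Real.pow_rpow_inv_natCast (by positivity) hk0
  have h2 : (∑ x, (u x + v x) ^ k) ^ (k : ℝ)⁻¹ ≤ c * (A + B) := by
    rw [mul_add]
    exact hM.trans (add_le_add (key u A hu hA hAu) (key v B hv hB hBv))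
  have h3 := pow_le_pow_left₀ (Real.rpow_nonneg
    (Finset.sum_nonneg fun x _ => pow_nonneg (add_nonneg (hu x) (hv x)) k) _) h2 k
  rw [Real.rpow_inv_natCast_pow
    (Finset.sum_nonneg fun x _ => pow_nonneg (add_nonneg (hu x) (hv x)) k) hk0, mul_pow, hck] at h3
  rw [cubeMean, div_le_iff₀ (by positivity), mul_comm]
  exact h3

lemma two_point_aux (h g : ℝ) (k : ℕ) :
    0 ≤ h * g * ((h + g) ^ (2 * k) - (h - g) ^ (2 * k)) ∧
      h * g * ((h + g) ^ (2 * k) - (h - g) ^ (2 * k)) ≤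
        2 * k * g ^ 2 * ((h + g) ^ (2 * k) + (h - g) ^ (2 * k)) := by
  induction k with
  | zero => simp
  | succ k ih =>
    have hE : 0 ≤ (h + g) ^ (2 * k) + (h - g) ^ (2 * k) := by
      rw [pow_mul, pow_mul]; positivity
    have e1 : (h + g) ^ (2 * (k + 1)) = (h + g) ^ (2 * k) * (h + g) ^ 2 := by ring
    have e2 : (h - g) ^ (2 * (k + 1)) = (h - g) ^ (2 * k) * (h - g) ^ 2 := by ring
    rw [e1, e2]
    generalize (h + g) ^ (2 * k) = X at *
    generalize (h - g) ^ (2 * k) = Y at *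
    obtain ⟨ih0, ih1⟩ := ih
    have eO : h * g * (X * (h + g) ^ 2 - Y * (h - g) ^ 2) =
        (h ^ 2 + g ^ 2) * (h * g * (X - Y)) + 2 * h ^ 2 * g ^ 2 * (X + Y) := by ring
    have eE : X * (h + g) ^ 2 + Y * (h - g) ^ 2 =
        (h ^ 2 + g ^ 2) * (X + Y) + 2 * (h * g * (X - Y)) := by ring
    rw [eO, eE]
    constructor
    · positivity
    · have t1 := mul_le_mul_of_nonneg_left ih1 (by positivity : 0 ≤ h ^ 2 + g ^ 2)
      have t2 : 0 ≤ g ^ 2 * (k + 1) * (h * g * (X - Y)) := by positivity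
      have t3 : 0 ≤ g ^ 2 * g ^ 2 * (X + Y) := by positivity
      push_cast
      nlinarith

/-- The two-point hypercontractive inequality for even integer exponents. -/
lemma two_point_inequality (h g : ℝ) (k : ℕ) :
    ((h + g) ^ (2 * k) + (h - g) ^ (2 * k)) / 2 ≤ (h ^ 2 + (2 * k - 1) * g ^ 2) ^ k := by
  induction k with
  | zero => simp
  | succ k ih =>
    rcases Nat.eq_zero_or_pos k with rfl | hk
    · simp; nlinarith
    have hk1 : (1 : ℝ) ≤ k := by exact_mod_cast hk
    have haux := (two_point_aux h g k).2
    have step : ((h + g) ^ (2 * (k + 1)) + (h - g) ^ (2 * (k + 1))) / 2 ≤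
        (h ^ 2 + (4 * k + 1) * g ^ 2) * (((h + g) ^ (2 * k) + (h - g) ^ (2 * k)) / 2) := by
      have e1 : (h + g) ^ (2 * (k + 1)) = (h + g) ^ (2 * k) * (h + g) ^ 2 := by ring
      have e2 : (h - g) ^ (2 * (k + 1)) = (h - g) ^ (2 * k) * (h - g) ^ 2 := by ring
      rw [e1, e2]
      nlinarith
    refine (step.trans (mul_le_mul_of_nonneg_left ih (by positivity))).trans ?_
    push_cast
    have hY : 0 ≤ h ^ 2 + (2 * k - 1) * g ^ 2 := by
      have : (0 : ℝ) ≤ 2 * k - 1 := by linarith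
      positivity
    set X := h ^ 2 + (2 * (k + 1 : ℝ) - 1) * g ^ 2 with hX
    have hXY : h ^ 2 + (2 * k - 1) * g ^ 2 = X - 2 * g ^ 2 := by rw [hX]; ring
    have hZ : h ^ 2 + (4 * k + 1) * g ^ 2 = X + 2 * k * g ^ 2 := by rw [hX]; ring
    rw [hXY] at hY
    rw [hXY, hZ]
    rcases (show 0 ≤ X by nlinarith).eq_or_lt with hX0 | hX0
    · have hg : g ^ 2 = 0 := by nlinarith [sq_nonneg g]
      rw [hg, ← hX0]; simp
    · set t := 2 * g ^ 2 / X with ht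
      have ht0 : 0 ≤ t := by positivity
      have ht1 : t ≤ 1 := by rw [ht, div_le_one hX0]; linarith
      have e1 : X - 2 * g ^ 2 = X * (1 - t) := by rw [ht]; field_simp
      have e2 : X + 2 * k * g ^ 2 = X * (1 + k * t) := by rw [ht]; field_simp
      have hb : (1 + k * t) * (1 - t) ^ k ≤ 1 := by
        have := one_add_mul_le_pow (by linarith : (-2 : ℝ) ≤ t) k
        calc (1 + k * t) * (1 - t) ^ k ≤ (1 + t) ^ k * (1 - t) ^ k :=
              mul_le_mul_of_nonneg_right this (pow_nonneg (by linarith) k)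
          _ = (1 - t ^ 2) ^ k := by rw [← mul_pow]; ring
          _ ≤ 1 := pow_le_one₀ (by nlinarith) (by nlinarith)
      rw [e1, e2, mul_pow]
      calc X * (1 + k * t) * (X ^ k * (1 - t) ^ k)
          = X ^ (k + 1) * ((1 + k * t) * (1 - t) ^ k) := by ring
        _ ≤ X ^ (k + 1) * 1 := mul_le_mul_of_nonneg_left hb (by positivity)
        _ = _ := mul_one _

/-- Hypercontractivity on the discrete cube: the moment comparison for polynomials of degree less
than `d`. -/
lemma cube_hypercontractive {k : ℕ} (hk : 1 ≤ k) : ∀ {n d : ℕ} {f : (Fin n → Bool) → ℝ},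
    f ∈ cubeDegreeLT n d →
      (2 * k - 1 : ℝ) ^ k * cubeMean (fun x => f x ^ (2 * k)) ≤
        ((2 * k - 1 : ℝ) ^ d * cubeMean fun x => f x ^ 2) ^ k
  | n, 0, f, hf => by
    simp [eq_zero_of_mem_cubeDegreeLT_zero hf, cubeMean, show k ≠ 0 by omega]
  | 0, d + 1, f, _ => by
    have hC : (1 : ℝ) ≤ 2 * k - 1 := by
      have : (1 : ℝ) ≤ k := by exact_mod_cast hk
      linarith
    simp only [cubeMean, Finset.univ_unique, Finset.sum_singleton, pow_zero, div_one]
    rw [pow_mul, ← mul_pow]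
    have h1 := le_self_pow₀ hC (Nat.succ_ne_zero d)
    gcongr
  | n + 1, d + 1, f, hf => by
    have hC : (1 : ℝ) ≤ 2 * k - 1 := by
      have : (1 : ℝ) ≤ k := by exact_mod_cast hk
      linarith
    rw [mem_cubeDegreeLT_succ, Nat.add_sub_cancel] at hf
    have ih0 := cube_hypercontractive hk hf.1
    have ih1 := cube_hypercontractive hk hf.2
    rw [cubeMean_succ, cubeMean_succ]
    simp only [eval_cons_true, eval_cons_false]
    generalize evenPart n f = h at *
    generalize oddPart n f = g at *
    set C : ℝ := 2 * k - 1 with hCdef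
    have hC0 : 0 ≤ C := by linarith
    have hsq : (cubeMean (fun x => (h x + g x) ^ 2) + cubeMean fun x => (h x - g x) ^ 2) / 2 =
        cubeMean (fun x => h x ^ 2) + cubeMean fun x => g x ^ 2 := by
      rw [← cubeMean_add, ← cubeMean_add]
      have : (fun x => (h x + g x) ^ 2 + (h x - g x) ^ 2) =
          fun x => 2 * (h x ^ 2 + g x ^ 2) := by ext x; ring
      rw [this, cubeMean_const_mul]; ring
    have hpt : C ^ k * ((cubeMean (fun x => (h x + g x) ^ (2 * k)) +
        cubeMean fun x => (h x - g x) ^ (2 * k)) / 2) ≤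
        cubeMean fun x => (C * h x ^ 2 + C * (C * g x ^ 2)) ^ k := by
      rw [← cubeMean_add, div_eq_inv_mul, ← cubeMean_const_mul, ← cubeMean_const_mul]
      refine cubeMean_mono fun x => ?_
      rw [← mul_add, mul_pow, ← div_eq_inv_mul]
      exact mul_le_mul_of_nonneg_left (two_point_inequality _ _ _) (by positivity)
    refine hpt.trans ?_
    rw [hsq, mul_add]
    refine cubeMean_add_pow_le hk (fun x => by positivity) (fun x => by positivity)
      (mul_nonneg (by positivity) (cubeMean_nonneg fun x => sq_nonneg _))
      (mul_nonneg (by positivity) (cubeMean_nonneg fun x => sq_nonneg _)) ?_ ?_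
    · refine le_trans (le_of_eq ?_) ih0
      rw [← cubeMean_const_mul]
      congr 1; ext x; rw [mul_pow, pow_mul]
    · rw [pow_succ', mul_assoc, mul_pow C]
      refine le_trans (le_of_eq ?_) (mul_le_mul_of_nonneg_left ih1 (by positivity))
      rw [← cubeMean_const_mul, ← cubeMean_const_mul]
      congr 1; ext x; rw [mul_pow, mul_pow, pow_mul]

/-- The mean of `f` at a sum of `N` independent random signs. -/
noncomputable def signSumMean (N : ℕ) (f : ℝ → ℝ) : ℝ :=
  cubeMean fun x : Fin N → Bool => f (∑ l, bitSign (x l))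

lemma signSumMean_succ (N : ℕ) (f : ℝ → ℝ) :
    signSumMean (N + 1) f = signSumMean N fun t => (f (t + 1) + f (t - 1)) / 2 := by
  simp only [signSumMean, div_eq_inv_mul _ (2 : ℝ)]
  rw [cubeMean_succ, cubeMean_const_mul, cubeMean_add, div_eq_inv_mul]
  simp [Fin.sum_univ_succ, bitSign, add_comm, sub_eq_add_neg]

/-- A discrete version of Gaussian integration by parts. -/
lemma signSumMean_id_mul (N : ℕ) (f : ℝ → ℝ) :
    signSumMean (N + 1) (fun t => t * f t) =
      (N + 1) * signSumMean N fun t => (f (t + 1) - f (t - 1)) / 2 := by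
  induction N generalizing f with
  | zero => simp [signSumMean_succ]; simp [signSumMean, cubeMean]; ring
  | succ N ih =>
    have h1 : (fun t => ((t + 1) * f (t + 1) + (t - 1) * f (t - 1)) / 2) =
        fun t => t * ((f (t + 1) + f (t - 1)) / 2) + (f (t + 1) - f (t - 1)) / 2 := by
      ext t; ring
    have h2 := ih fun t => (f (t + 1) + f (t - 1)) / 2
    have h3 := signSumMean_succ N fun t => (f (t + 1) - f (t - 1)) / 2
    have h4 : (fun t => ((f (t + 1 + 1) + f (t + 1 - 1)) / 2 -
        (f (t - 1 + 1) + f (t - 1 - 1)) / 2) / 2) =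
        fun t => ((f (t + 1 + 1) - f (t + 1 - 1)) / 2 +
          (f (t - 1 + 1) - f (t - 1 - 1)) / 2) / 2 := by
      ext t; rw [show t + 1 - 1 = t - 1 + 1 by ring]; ring
    rw [h4] at h2
    rw [signSumMean_succ, h1]
    have h5 : ∀ u v : ℝ → ℝ, signSumMean (N + 1) (fun t => u t + v t) =
        signSumMean (N + 1) u + signSumMean (N + 1) v := fun u v => cubeMean_add _ _
    rw [h5, h2, h3]
    push_cast; ring

lemma cubeMean_sum {ι : Type*} {n : ℕ} (s : Finset ι) (f : ι → (Fin n → Bool) → ℝ) :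
    cubeMean (fun x => ∑ i ∈ s, f i x) = ∑ i ∈ s, cubeMean (f i) := by
  simp only [cubeMean, ← Finset.sum_div]
  rw [Finset.sum_comm]

/-- The moments of a normalized sum of independent random signs. -/
noncomputable def signSumMoment (j N : ℕ) : ℝ :=
  cubeMean fun x : Fin N → Bool => ((∑ l, bitSign (x l)) / √N) ^ j

lemma signSumMoment_succ (J N : ℕ) (hN : 0 < N) :
    signSumMoment (J + 2) (N + 1) = ∑ l ∈ Finset.range (J + 1),
      ((J + 1).choose l * (1 - (-1) ^ (J + 1 - l)) / 2 * signSumMoment l N *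
        (√N / √(N + 1)) ^ l * (1 / √(N + 1)) ^ (J - l)) := by
  have hN' : (0 : ℝ) < N := by exact_mod_cast hN
  have hs : 0 < √(N : ℝ) := Real.sqrt_pos.2 hN'
  have hs1 : 0 < √((N : ℝ) + 1) := Real.sqrt_pos.2 (by linarith)
  have hsq : √((N : ℝ) + 1) ^ 2 = N + 1 := Real.sq_sqrt (by linarith)
  have h1 : signSumMoment (J + 2) (N + 1) = (√((N : ℝ) + 1) ^ (J + 2))⁻¹ *
      signSumMean (N + 1) (fun t => t * t ^ (J + 1)) := by
    rw [signSumMoment, signSumMean, ← cubeMean_const_mul]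
    congr 1; ext x; push_cast; rw [div_pow]; ring
  have h2 : ∀ t : ℝ, ((t + 1) ^ (J + 1) - (t - 1) ^ (J + 1)) / 2 =
      ∑ l ∈ Finset.range (J + 1),
        ((J + 1).choose l * (1 - (-1) ^ (J + 1 - l)) / 2 * √N ^ l) * (t / √N) ^ l := by
    intro t
    rw [sub_eq_add_neg t, add_pow, add_pow, ← Finset.sum_sub_distrib, Finset.sum_range_succ]
    simp only [one_pow, mul_one, Nat.sub_self, pow_zero, sub_self, add_zero]
    rw [Finset.sum_div]
    refine Finset.sum_congr rfl fun l _ => ?_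
    rw [div_pow]; field_simp
  rw [h1, signSumMean_id_mul]
  simp only [h2, signSumMean]
  rw [cubeMean_sum, Finset.mul_sum, Finset.mul_sum]
  refine Finset.sum_congr rfl fun l hl => ?_
  rw [cubeMean_const_mul, ← signSumMoment]
  obtain ⟨i, rfl⟩ := Nat.exists_eq_add_of_le (Nat.lt_succ_iff.1 (Finset.mem_range.1 hl))
  generalize √((N : ℝ) + 1) = r at *
  rw [Nat.add_sub_cancel_left, ← hsq, div_pow, div_pow, one_pow]
  field_simp
  ring

lemma integral_pow_gaussianReal (j : ℕ) :
    ∫ x, x ^ (j + 2) ∂(gaussianReal 0 1) = (j + 1) * ∫ x, x ^ j ∂(gaussianReal 0 1) := by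
  have hm : ∀ n, ∫ x, x ^ n ∂(gaussianReal 0 1) =
      iteratedDeriv n (fun t : ℝ => Real.exp (t ^ 2 / 2)) 0 := by
    intro n
    have h := iteratedDeriv_mgf_zero (X := id) (μ := gaussianReal 0 1)
      (by simp [integrableExpSet_id_gaussianReal]) n
    rw [mgf_id_gaussianReal] at h
    simpa using h.symm
  have hc : ContDiff ℝ ⊤ (fun t : ℝ => Real.exp (t ^ 2 / 2)) := by fun_prop
  have hrec : ∀ n t, iteratedDeriv (n + 2) (fun t : ℝ => Real.exp (t ^ 2 / 2)) t =
      t * iteratedDeriv (n + 1) (fun t : ℝ => Real.exp (t ^ 2 / 2)) t +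
        (n + 1) * iteratedDeriv n (fun t : ℝ => Real.exp (t ^ 2 / 2)) t := by
    have hd : ∀ n, Differentiable ℝ (iteratedDeriv n fun t : ℝ => Real.exp (t ^ 2 / 2)) :=
      fun n => hc.differentiable_iteratedDeriv n (by simp)
    have h1 : iteratedDeriv 1 (fun t : ℝ => Real.exp (t ^ 2 / 2)) =
        fun t => t * Real.exp (t ^ 2 / 2) := by
      rw [iteratedDeriv_one]
      ext t
      have : HasDerivAt (fun t : ℝ => Real.exp (t ^ 2 / 2))
          (Real.exp (t ^ 2 / 2) * ((2 : ℕ) * t ^ (2 - 1) / 2)) t :=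
        ((hasDerivAt_pow 2 t).div_const 2).exp
      rw [this.deriv]; push_cast; ring
    intro n
    induction n with
    | zero =>
      intro t
      rw [iteratedDeriv_succ, h1]
      have h2 := (hasDerivAt_id t).mul (hd 0 t).hasDerivAt
      rw [← iteratedDeriv_succ, h1, iteratedDeriv_zero] at h2
      simp only [id, Pi.mul_def] at h2
      rw [h2.deriv]
      simp; ring
    | succ n ih =>
      intro t
      have e : iteratedDeriv (n + 1 + 2) (fun t : ℝ => Real.exp (t ^ 2 / 2)) t = deriv (fun t =>
          t * iteratedDeriv (n + 1) (fun t : ℝ => Real.exp (t ^ 2 / 2)) t +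
            (n + 1) * iteratedDeriv n (fun t : ℝ => Real.exp (t ^ 2 / 2)) t) t := by
        rw [iteratedDeriv_succ, funext ih]
      have h2 := ((hasDerivAt_id t).mul (hd (n + 1) t).hasDerivAt).add
        ((hd n t).hasDerivAt.const_mul (n + 1 : ℝ))
      rw [← iteratedDeriv_succ, ← iteratedDeriv_succ] at h2
      simp only [id, Pi.mul_def, Pi.add_def] at h2
      rw [e, h2.deriv]
      push_cast; ring
  rw [hm, hm, hrec]
  ring

lemma tendsto_sqrt_div_sqrt_succ :
    Filter.Tendsto (fun N : ℕ => √(N : ℝ) / √((N : ℝ) + 1)) Filter.atTop (nhds 1) := by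
  have h := (tendsto_natCast_div_add_atTop (1 : ℝ)).sqrt
  simpa [Real.sqrt_div] using h

/-- Moment convergence in the central limit theorem for random signs. -/
lemma tendsto_signSumMoment (j : ℕ) :
    Filter.Tendsto (signSumMoment j) Filter.atTop
      (nhds (∫ x, x ^ j ∂(gaussianReal 0 1))) := by
  induction j using Nat.strong_induction_on with
  | _ j ih =>
    match j, ih with
    | 0, _ =>
      have : signSumMoment 0 = fun _ => 1 := by
        ext N; simp [signSumMoment, cubeMean]
      simp [this]
    | 1, _ =>
      rw [← Filter.tendsto_add_atTop_iff_nat 1]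
      have : (fun N => signSumMoment 1 (N + 1)) = fun _ => 0 := by
        ext N
        have h := signSumMean_id_mul N fun _ => 1
        simp only [mul_one, sub_self, zero_div, signSumMean] at h
        simp only [signSumMoment, pow_one, div_eq_inv_mul]
        rw [cubeMean_const_mul, h]
        simp [cubeMean]
      simp [this, integral_id_gaussianReal]
    | J + 2, ih =>
      rw [← Filter.tendsto_add_atTop_iff_nat 1, integral_pow_gaussianReal]
      have h0 : Filter.Tendsto (fun N : ℕ => 1 / √((N : ℝ) + 1)) Filter.atTop (nhds 0) := by
        have := (tendsto_one_div_add_atTop_nhds_zero_nat (𝕜 := ℝ)).sqrt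
        simpa using this
      have hsum : Filter.Tendsto (fun N : ℕ => ∑ l ∈ Finset.range (J + 1),
          ((J + 1).choose l * (1 - (-1) ^ (J + 1 - l)) / 2 * signSumMoment l N *
            (√N / √(N + 1)) ^ l * (1 / √(N + 1)) ^ (J - l) : ℝ)) Filter.atTop
          (nhds (∑ l ∈ Finset.range (J + 1),
            ((J + 1).choose l * (1 - (-1) ^ (J + 1 - l)) / 2 *
              (∫ x, x ^ l ∂(gaussianReal 0 1)) * 1 ^ l * 0 ^ (J - l) : ℝ))) := by
        refine tendsto_finsetSum _ fun l hl => ?_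
        exact (((ih l (by have := Finset.mem_range.1 hl; omega)).const_mul _).mul
          (tendsto_sqrt_div_sqrt_succ.pow l)).mul (h0.pow _)
      rw [Finset.sum_range_succ, Finset.sum_eq_zero] at hsum
      · have e : (J + 1 : ℕ) - J = 1 := by omega
        rw [e] at hsum
        simp only [Nat.sub_self, pow_zero, one_pow, mul_one, zero_add, Nat.choose_succ_self_right,
          pow_one] at hsum
        have hlim : ((J + 1 : ℕ) : ℝ) * (1 - -1) / 2 * ∫ x, x ^ J ∂(gaussianReal 0 1) =
            (J + 1) * ∫ x, x ^ J ∂(gaussianReal 0 1) := by push_cast; ring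
        rw [hlim] at hsum
        refine hsum.congr' ?_
        filter_upwards [Filter.eventually_gt_atTop 0] with N hN
        exact (signSumMoment_succ J N hN).symm
      · intro l hl
        have : J - l ≠ 0 := by have := Finset.mem_range.1 hl; omega
        simp [this]

/-- The `i`-th normalized sum of signs, when `m * N` signs are grouped into `m` blocks. -/
noncomputable def blockSum (m N : ℕ) (i : Fin m) (x : Fin (m * N) → Bool) : ℝ :=
  (∑ l, bitSign (x (finProdFinEquiv (i, l)))) / √N

lemma blockSum_mem_cubeDegreeLT (m N : ℕ) (i : Fin m) :
    blockSum m N i ∈ cubeDegreeLT (m * N) 2 := by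
  have h : blockSum m N i = (√(N : ℝ))⁻¹ •
      ∑ l, fun x : Fin (m * N) → Bool => bitSign (x (finProdFinEquiv (i, l))) := by
    ext x
    simp [blockSum, div_eq_inv_mul]
  rw [h]
  exact Submodule.smul_mem _ _ (Submodule.sum_mem _ fun l _ => bitSign_mem_cubeDegreeLT _)

lemma cubeMean_prod_blockSum (m N : ℕ) (s : Fin m → ℕ) :
    cubeMean (fun x => ∏ i, blockSum m N i x ^ s i) = ∏ i, signSumMoment (s i) N := by
  let e : (Fin m → Fin N → Bool) ≃ (Fin (m * N) → Bool) :=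
    (Equiv.curry _ _ _).symm.trans (Equiv.arrowCongr finProdFinEquiv (Equiv.refl _))
  have h : ∀ y i, blockSum m N i (e y) = (∑ l, bitSign (y i l)) / √N := by
    intro y i
    simp [blockSum, e, Function.uncurry]
  simp only [cubeMean, signSumMoment]
  rw [← e.sum_comp, Finset.prod_div_distrib, Finset.prod_univ_sum, Fintype.piFinset_univ]
  simp [h, ← pow_mul, mul_comm]

lemma integrable_prod_pow_pi_gaussianReal {m : ℕ} (s : Fin m → ℕ) :
    Integrable (fun ξ : Fin m → ℝ => ∏ i, ξ i ^ s i)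
      (Measure.pi fun _ : Fin m => gaussianReal 0 1) := by
  refine Integrable.fintype_prod (f := fun i t => t ^ s i) fun i => ?_
  have h := (memLp_id_gaussianReal (μ := 0) (v := 1) (s i)).integrable_norm_pow'
  refine (integrable_norm_iff (by fun_prop)).1 ?_
  simpa using h

lemma integrable_eval_pi_gaussianReal {m : ℕ} (Q : MvPolynomial (Fin m) ℝ) :
    Integrable (fun ξ : Fin m → ℝ => MvPolynomial.eval ξ Q)
      (Measure.pi fun _ : Fin m => gaussianReal 0 1) := by
  simp only [MvPolynomial.eval_eq']
  exact integrable_finsetSum _ fun s _ => (integrable_prod_pow_pi_gaussianReal s).const_mul _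

lemma tendsto_cubeMean_eval {m : ℕ} (Q : MvPolynomial (Fin m) ℝ) :
    Filter.Tendsto
      (fun N => cubeMean fun x => MvPolynomial.eval (fun i => blockSum m N i x) Q) Filter.atTop
      (nhds (∫ ξ, MvPolynomial.eval ξ Q ∂(Measure.pi fun _ : Fin m => gaussianReal 0 1))) := by
  simp only [MvPolynomial.eval_eq']
  rw [integral_finsetSum (f := fun s (ξ : Fin m → ℝ) => Q.coeff s * ∏ i, ξ i ^ s i) _
    fun s _ => (integrable_prod_pow_pi_gaussianReal s).const_mul _]
  simp only [cubeMean_sum, cubeMean_const_mul, integral_const_mul]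
  refine tendsto_finsetSum _ fun s _ => Filter.Tendsto.const_mul _ ?_
  simp only [cubeMean_prod_blockSum]
  rw [integral_fintype_prod_eq_prod (f := fun i (t : ℝ) => t ^ s i)]
  exact tendsto_finsetProd _ fun i _ => tendsto_signSumMoment (s i)

/-- Gaussian hypercontractivity for polynomials and even integer exponents. -/
lemma gaussian_hypercontractive {m d k : ℕ} (hk : 1 ≤ k) {P : MvPolynomial (Fin m) ℝ}
    (hP : P.totalDegree ≤ d) :
    ∫ ξ, MvPolynomial.eval ξ P ^ (2 * k) ∂(Measure.pi fun _ : Fin m => gaussianReal 0 1) ≤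
      ((2 * k - 1 : ℝ) ^ d *
        ∫ ξ, MvPolynomial.eval ξ P ^ 2 ∂(Measure.pi fun _ : Fin m => gaussianReal 0 1)) ^ k := by
  have hC : (0 : ℝ) < 2 * k - 1 := by
    have : (1 : ℝ) ≤ k := by exact_mod_cast hk
    linarith
  have h1 := tendsto_cubeMean_eval (P ^ (2 * k))
  have h2 := ((tendsto_cubeMean_eval (P ^ 2)).const_mul ((2 * k - 1 : ℝ) ^ d)).pow k
  simp only [map_pow] at h1 h2
  refine le_of_tendsto_of_tendsto' h1 h2 fun N => ?_
  have h := cube_hypercontractive hk (eval_mem_cubeDegreeLT hP (blockSum_mem_cubeDegreeLT m N))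
  rw [pow_succ', mul_assoc, mul_pow (2 * k - 1 : ℝ)] at h
  exact le_of_mul_le_mul_left h (by positivity)

lemma measure_eval_ge_le {m k : ℕ} (hk : 1 ≤ k) {P : MvPolynomial (Fin m) ℝ}
    (hP : P.totalDegree ≤ 4) {c a : ℝ} (hc : 0 < c) (ha : 0 < a)
    (h : c * (∫ ξ : Fin m → ℝ, (MvPolynomial.eval ξ P) ^ 2
      ∂(Measure.pi fun _ : Fin m => gaussianReal 0 1)) ^ ((1 : ℝ) / 2) ≤ a) :
    ((Measure.pi fun _ : Fin m => gaussianReal 0 1)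
      {ξ : Fin m → ℝ | a ≤ MvPolynomial.eval ξ P}).toReal ≤
        ((2 * k - 1 : ℝ) ^ 2 / c) ^ (2 * k) := by
  set μ := Measure.pi fun _ : Fin m => gaussianReal 0 1
  set V := ∫ ξ : Fin m → ℝ, (MvPolynomial.eval ξ P) ^ 2 ∂μ with hV
  have hV0 : 0 ≤ V := integral_nonneg fun ξ => sq_nonneg _
  have hVa : c ^ 2 * V ≤ a ^ 2 := by
    have := pow_le_pow_left₀ (by positivity) h 2
    rwa [mul_pow, ← Real.sqrt_eq_rpow, Real.sq_sqrt hV0] at this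
  have hint : Integrable (fun ξ => MvPolynomial.eval ξ P ^ (2 * k)) μ := by
    simpa using integrable_eval_pi_gaussianReal (P ^ (2 * k))
  have hmarkov := mul_meas_ge_le_integral_of_nonneg
    (ae_of_all μ fun ξ => by
      simp only [Pi.zero_apply]; rw [pow_mul]; positivity) hint (a ^ (2 * k))
  have hsub : μ.real {ξ | a ≤ MvPolynomial.eval ξ P} ≤
      μ.real {ξ | a ^ (2 * k) ≤ MvPolynomial.eval ξ P ^ (2 * k)} :=
    measureReal_mono fun ξ hξ => pow_le_pow_left₀ ha.le hξ _
  have hhyp := gaussian_hypercontractive hk hP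
  change μ.real _ ≤ _
  refine hsub.trans ?_
  have hC : (0 : ℝ) < 2 * k - 1 := by
    have : (1 : ℝ) ≤ k := by exact_mod_cast hk
    linarith
  have hbound : ((2 * k - 1 : ℝ) ^ 4 * V) ^ k ≤
      a ^ (2 * k) * ((2 * k - 1 : ℝ) ^ 2 / c) ^ (2 * k) := by
    rw [← mul_pow, pow_mul _ 2 k]
    refine pow_le_pow_left₀ (by positivity) ?_ k
    have : V ≤ a ^ 2 / c ^ 2 := by rw [le_div_iff₀ (by positivity)]; linarith
    calc (2 * k - 1 : ℝ) ^ 4 * V ≤ (2 * k - 1 : ℝ) ^ 4 * (a ^ 2 / c ^ 2) := by gcongr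
      _ = _ := by rw [mul_pow, div_pow]; ring
  exact le_of_mul_le_mul_left (hmarkov.trans (hhyp.trans hbound)) (by positivity)

lemma exponent_bound {q L : ℝ} {k : ℕ} (hq : 2 < q) (hk : 1 ≤ k) (hkq : |2 * k - q| ≤ 1)
    (hL : L * (q + 1) = 2 * q ^ 2) :
    ((2 * k - 1 : ℝ) ^ 2 / ((q - 1) ^ 2 * Real.exp (2 * q / (q - 1)))) ^ (2 * k) ≤
      Real.exp (-L) := by
  have hq1 : 0 < q - 1 := by linarith
  have hk1 : (1 : ℝ) ≤ k := by exact_mod_cast hk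
  set D := 2 * k - q with hD
  have hp : (2 * k - 1 : ℝ) = (q - 1) * (1 + D / (q - 1)) := by rw [hD]; field_simp; ring
  have h1 : (2 * k - 1 : ℝ) ≤ (q - 1) * Real.exp (D / (q - 1)) := by
    rw [hp]
    have := Real.add_one_le_exp (D / (q - 1))
    gcongr; linarith
  have h2 : (2 * k - 1 : ℝ) ^ 2 / ((q - 1) ^ 2 * Real.exp (2 * q / (q - 1))) ≤
      Real.exp (2 * (D - q) / (q - 1)) := by
    rw [div_le_iff₀ (by positivity)]
    calc (2 * k - 1 : ℝ) ^ 2 ≤ ((q - 1) * Real.exp (D / (q - 1))) ^ 2 :=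
          pow_le_pow_left₀ (by linarith) h1 2
      _ = (q - 1) ^ 2 * Real.exp (2 * (D - q) / (q - 1) + 2 * q / (q - 1)) := by
          rw [mul_pow, ← Real.exp_nat_mul]; congr 2; push_cast; ring
      _ = _ := by rw [Real.exp_add]; ring
  refine (pow_le_pow_left₀ (by positivity) h2 _).trans ?_
  rw [← Real.exp_nat_mul, Real.exp_le_exp]
  have hLe : L = 2 * q ^ 2 / (q + 1) := by rw [eq_div_iff (by linarith)]; exact hL
  have hD2 : D ^ 2 ≤ 1 := (sq_le_one_iff_abs_le_one D).2 hkq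
  have e : ((2 * k : ℕ) : ℝ) * (2 * (D - q) / (q - 1)) = -(2 * (q ^ 2 - D ^ 2) / (q - 1)) := by
    have : ((2 * k : ℕ) : ℝ) = q + D := by rw [hD]; push_cast; ring
    rw [this]; ring
  rw [e, hLe, neg_le_neg_iff, div_le_div_iff₀ (by linarith) hq1]
  nlinarith

lemma exists_even_near {q : ℝ} (hq : 2 < q) : ∃ k : ℕ, 1 ≤ k ∧ |2 * (k : ℝ) - q| ≤ 1 := by
  have h0 : 0 ≤ (q + 1) / 2 := by linarith
  have h1 := Nat.floor_le h0
  have h2 := Nat.lt_floor_add_one ((q + 1) / 2)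
  refine ⟨⌊(q + 1) / 2⌋₊, Nat.le_floor (by push_cast; linarith), ?_⟩
  rw [abs_le]
  constructor <;> linarith

lemma two_lt_qFun {ρ : ℝ} (hρ : ρ ∈ Set.Ioc (0 : ℝ) (Real.exp (-8))) :
    2 < qFun ρ ∧ -Real.log ρ * (qFun ρ + 1) = 2 * qFun ρ ^ 2 := by
  have hL : Real.log ρ ≤ -8 := (Real.log_le_iff_le_exp hρ.1).2 hρ.2
  have hq : qFun ρ = (-Real.log ρ + Real.sqrt ((Real.log ρ) ^ 2 - 8 * Real.log ρ)) / 4 :=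
    if_pos hρ
  have hs : (Real.log ρ) ^ 2 - 8 * Real.log ρ =
      Real.sqrt ((Real.log ρ) ^ 2 - 8 * Real.log ρ) ^ 2 := (Real.sq_sqrt (by nlinarith)).symm
  have hpos : 0 < Real.sqrt ((Real.log ρ) ^ 2 - 8 * Real.log ρ) :=
    Real.sqrt_pos.2 (by nlinarith)
  rw [hq]
  generalize Real.sqrt ((Real.log ρ) ^ 2 - 8 * Real.log ρ) = r at *
  constructor
  · linarith
  · linear_combination hs / 8

/-- Part (b) of the paper's Theorem 1 in self-contained form: for a quartic Gaussian
polynomial `P`, the condition `a₀ ≥ c(ρ) (E[P(ξ)²])^{1/2}` is a safe approximation of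
the chance constraint `Pr(P(ξ) ≥ a₀) ≤ ρ`. -/
theorem stmt_6 (m : ℕ) (P : MvPolynomial (Fin m) ℝ) (hP : P.totalDegree ≤ 4)
    (ρ : ℝ) (hρ : ρ ∈ Set.Ioo (0 : ℝ) 1)
    (a₀ : ℝ) (ha₀ : 0 < a₀)
    (hbd : cFun ρ *
        (∫ ξ : Fin m → ℝ, (MvPolynomial.eval ξ P) ^ 2
          ∂(Measure.pi fun _ : Fin m => gaussianReal 0 1)) ^ ((1 : ℝ) / 2) ≤ a₀) :
    ((Measure.pi fun _ : Fin m => gaussianReal 0 1)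
      {ξ : Fin m → ℝ | a₀ ≤ MvPolynomial.eval ξ P}).toReal ≤ ρ := by
  obtain ⟨hρ0, hρ1⟩ := hρ
  by_cases hρ8 : ρ ∈ Set.Ioc (0 : ℝ) (Real.exp (-8))
  · obtain ⟨hq, hL⟩ := two_lt_qFun hρ8
    have hc : cFun ρ = (qFun ρ - 1) ^ 2 * Real.exp (2 * qFun ρ / (qFun ρ - 1)) := if_pos hq
    have hq1 : 0 < qFun ρ - 1 := by linarith
    obtain ⟨k, hk, hkq⟩ := exists_even_near hq
    refine (measure_eval_ge_le hk hP (hc ▸ by positivity) ha₀ hbd).trans ?_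
    rw [hc]
    refine (exponent_bound hq hk hkq hL).trans_eq ?_
    rw [neg_neg, Real.exp_log hρ0]
  · have hq : qFun ρ = 2 := if_neg hρ8
    have hc : cFun ρ = 1 / Real.sqrt ρ := if_neg (by rw [hq]; exact lt_irrefl _)
    refine (measure_eval_ge_le le_rfl hP (hc ▸ by positivity) ha₀ hbd).trans_eq ?_
    rw [hc]
    norm_num [Real.sq_sqrt hρ0.le]
end

section
/- Let ξ be distributed according to the product measure N(0,1)^{⊗m} on ℝ^m and set Q(ξ) = ξᵀAξ + aᵀξ, where A is a real symmetric m×m matrix and a ∈ ℝ^m. Let ρ ∈ (exp(−8), 0.00045) and let t ∈ ℝ satisfy t ≥ (1/√ρ) · (E[Q(ξ)²])^{1/2}. Then t ≥ tr A + 2√(ln(1/ρ)) · √(‖A‖_F² + (1/2)‖a‖₂²) + 2 ln(1/ρ) · s⁺(A). -/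
open MeasureTheory ProbabilityTheory
open scoped Matrix BigOperators

lemma deriv_mul_exp_sq_div_two {p p' : ℝ → ℝ} (hp : ∀ t, HasDerivAt p (p' t) t) :
    deriv (fun t ↦ p t * Real.exp (t ^ 2 / 2)) =
      fun t ↦ (p' t + t * p t) * Real.exp (t ^ 2 / 2) := by
  ext t
  have h : HasDerivAt (fun t : ℝ ↦ t ^ 2 / 2) t t := by
    convert! ((hasDerivAt_id t).pow 2).div_const 2 using 1
    simp
  convert! ((hp t).mul h.exp).deriv using 1
  ring

lemma integral_pow_stdGaussianReal (n : ℕ) :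
    ∫ x, x ^ n ∂gaussianReal 0 1 = iteratedDeriv n (fun t : ℝ ↦ Real.exp (t ^ 2 / 2)) 0 := by
  have h := iteratedDeriv_mgf_zero (X := fun x : ℝ ↦ x) (μ := gaussianReal 0 1) (by simp) n
  rw [mgf_fun_id_gaussianReal] at h
  simpa using h.symm

lemma iteratedDeriv_one_exp_sq_div_two :
    iteratedDeriv 1 (fun t : ℝ ↦ Real.exp (t ^ 2 / 2)) = fun t ↦ t * Real.exp (t ^ 2 / 2) := by
  rw [iteratedDeriv_one]
  simpa using deriv_mul_exp_sq_div_two (fun t ↦ hasDerivAt_const t (1 : ℝ))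

lemma iteratedDeriv_two_exp_sq_div_two :
    iteratedDeriv 2 (fun t : ℝ ↦ Real.exp (t ^ 2 / 2)) =
      fun t ↦ (1 + t * t) * Real.exp (t ^ 2 / 2) := by
  rw [iteratedDeriv_succ, iteratedDeriv_one_exp_sq_div_two]
  exact deriv_mul_exp_sq_div_two hasDerivAt_id

lemma iteratedDeriv_three_exp_sq_div_two :
    iteratedDeriv 3 (fun t : ℝ ↦ Real.exp (t ^ 2 / 2)) =
      fun t ↦ (t + t + t * (1 + t * t)) * Real.exp (t ^ 2 / 2) := by
  rw [iteratedDeriv_succ, iteratedDeriv_two_exp_sq_div_two]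
  refine deriv_mul_exp_sq_div_two (p := fun t ↦ 1 + t * t) fun t ↦ ?_
  simpa using ((hasDerivAt_id t).mul (hasDerivAt_id t)).const_add 1

lemma integral_sq_stdGaussianReal : ∫ x, x ^ 2 ∂gaussianReal 0 1 = 1 := by
  rw [integral_pow_stdGaussianReal, iteratedDeriv_two_exp_sq_div_two]
  simp

lemma integral_cube_stdGaussianReal : ∫ x, x ^ 3 ∂gaussianReal 0 1 = 0 := by
  rw [integral_pow_stdGaussianReal, iteratedDeriv_three_exp_sq_div_two]
  simp

lemma integral_pow_four_stdGaussianReal : ∫ x, x ^ 4 ∂gaussianReal 0 1 = 3 := by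
  rw [integral_pow_stdGaussianReal, iteratedDeriv_succ, iteratedDeriv_three_exp_sq_div_two,
    deriv_mul_exp_sq_div_two (p' := fun t ↦ 3 + 3 * t ^ 2)]
  · simp
  · intro t
    convert! ((hasDerivAt_id t).add (hasDerivAt_id t)).add ((hasDerivAt_id t).mul
      (((hasDerivAt_id t).mul (hasDerivAt_id t)).const_add 1)) using 1
    simp only [id, Pi.mul_apply]
    ring

lemma integrable_pow_stdGaussianReal (n : ℕ) :
    Integrable (fun x : ℝ ↦ x ^ n) (gaussianReal 0 1) :=
  integrable_pow_of_mem_interior_integrableExpSet (X := fun x : ℝ ↦ x) (by simp) n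

lemma memLp_quadratic_stdGaussianReal (l c : ℝ) :
    MemLp (fun x : ℝ ↦ l * x ^ 2 + c * x) 2 (gaussianReal 0 1) := by
  rw [memLp_two_iff_integrable_sq (by fun_prop)]
  have h : (fun x : ℝ ↦ (l * x ^ 2 + c * x) ^ 2) =
      fun x ↦ l ^ 2 * x ^ 4 + 2 * l * c * x ^ 3 + c ^ 2 * x ^ 2 := by
    ext x; ring
  rw [h]
  exact (((integrable_pow_stdGaussianReal 4).const_mul _).add
    ((integrable_pow_stdGaussianReal 3).const_mul _)).add
    ((integrable_pow_stdGaussianReal 2).const_mul _)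

lemma integral_quadratic_stdGaussianReal (l c : ℝ) :
    ∫ x, (l * x ^ 2 + c * x) ∂gaussianReal 0 1 = l := by
  rw [integral_add ((integrable_pow_stdGaussianReal 2).const_mul _)
    (by simpa using (integrable_pow_stdGaussianReal 1).const_mul c), integral_const_mul,
    integral_const_mul, integral_sq_stdGaussianReal, integral_id_gaussianReal]
  ring

lemma variance_quadratic_stdGaussianReal (l c : ℝ) :
    Var[fun x : ℝ ↦ l * x ^ 2 + c * x; gaussianReal 0 1] = 2 * l ^ 2 + c ^ 2 := by
  rw [variance_eq_sub (memLp_quadratic_stdGaussianReal l c), integral_quadratic_stdGaussianReal]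
  have h : (fun x : ℝ ↦ l * x ^ 2 + c * x) ^ 2 =
      fun x ↦ l ^ 2 * x ^ 4 + 2 * l * c * x ^ 3 + c ^ 2 * x ^ 2 := by
    ext x; simp only [Pi.pow_apply]; ring
  have h4 := (integrable_pow_stdGaussianReal 4).const_mul (l ^ 2)
  have h3 := (integrable_pow_stdGaussianReal 3).const_mul (2 * l * c)
  have h2 := (integrable_pow_stdGaussianReal 2).const_mul (c ^ 2)
  simp only [h]
  rw [integral_add (by exact h4.add h3) h2, integral_add h4 h3, integral_const_mul, integral_const_mul,
    integral_const_mul, integral_sq_stdGaussianReal, integral_cube_stdGaussianReal,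
    integral_pow_four_stdGaussianReal]
  ring

lemma integral_sq_sum_quadratic_pi_stdGaussianReal {ι : Type*} [Fintype ι] (l c : ι → ℝ) :
    ∫ x : ι → ℝ, (∑ i, (l i * x i ^ 2 + c i * x i)) ^ 2 ∂(Measure.pi fun _ ↦ gaussianReal 0 1) =
      (∑ i, l i) ^ 2 + ∑ i, (2 * l i ^ 2 + c i ^ 2) := by
  have hL : ∀ i, MemLp (fun x : ι → ℝ ↦ l i * x i ^ 2 + c i * x i) 2
      (Measure.pi fun _ ↦ gaussianReal 0 1) := fun i ↦
    (memLp_quadratic_stdGaussianReal (l i) (c i)).comp_measurePreserving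
      (measurePreserving_eval (fun _ : ι ↦ gaussianReal 0 1) i)
  have hmean : ∫ x : ι → ℝ, ∑ i, (l i * x i ^ 2 + c i * x i)
      ∂(Measure.pi fun _ ↦ gaussianReal 0 1) = ∑ i, l i := by
    rw [integral_finsetSum _ fun i _ ↦ (hL i).integrable (by norm_num)]
    refine Finset.sum_congr rfl fun i _ ↦ ?_
    rw [integral_comp_eval (μ := fun _ : ι ↦ gaussianReal 0 1) (i := i)
      (f := fun y : ℝ ↦ l i * y ^ 2 + c i * y) (by fun_prop)]
    exact integral_quadratic_stdGaussianReal _ _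
  have hvar := variance_sum_pi (μ := fun _ : ι ↦ gaussianReal 0 1)
    fun i ↦ memLp_quadratic_stdGaussianReal (l i) (c i)
  simp_rw [variance_quadratic_stdGaussianReal] at hvar
  rw [variance_eq_sub (memLp_finsetSum' _ fun i _ ↦ hL i)] at hvar
  simp only [Finset.sum_apply, Pi.pow_apply] at hvar
  rw [hmean] at hvar
  linarith

lemma integral_pi_stdGaussianReal_comp_orthonormalBasis {ι : Type*} [Fintype ι]
    (b : OrthonormalBasis ι ℝ (EuclideanSpace ℝ ι)) {f : (ι → ℝ) → ℝ} (hf : Measurable f) :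
    ∫ x, f x ∂(Measure.pi fun _ : ι ↦ gaussianReal 0 1) =
      ∫ x, f (∑ i, x i • (b i).ofLp) ∂(Measure.pi fun _ : ι ↦ gaussianReal 0 1) := by
  have hf' : Measurable fun y : EuclideanSpace ℝ ι ↦ f y.ofLp := by fun_prop
  have h₁ : ∫ y, f y.ofLp ∂stdGaussian (EuclideanSpace ℝ ι) =
      ∫ x, f x ∂(Measure.pi fun _ : ι ↦ gaussianReal 0 1) := by
    rw [← map_pi_eq_stdGaussian, integral_map (by fun_prop) hf'.aestronglyMeasurable]
  rw [← h₁, stdGaussian_eq_map_pi_orthonormalBasis b,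
    integral_map (Measurable.aemeasurable (by fun_prop)) hf'.aestronglyMeasurable]
  simp

namespace Matrix.IsHermitian

variable {n : Type*} [Fintype n] [DecidableEq n] {A : Matrix n n ℝ}

lemma eigenvectorBasis_dotProduct (hA : A.IsHermitian) (i j : n) :
    (hA.eigenvectorBasis i).ofLp ⬝ᵥ (hA.eigenvectorBasis j).ofLp = if i = j then 1 else 0 := by
  rw [← orthonormal_iff_ite.mp hA.eigenvectorBasis.orthonormal i j,
    EuclideanSpace.inner_eq_star_dotProduct, dotProduct_comm]
  simp

lemma sum_dotProduct_eigenvectorBasis_sq (hA : A.IsHermitian) (v : n → ℝ) :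
    ∑ i, (v ⬝ᵥ (hA.eigenvectorBasis i).ofLp) ^ 2 = ∑ i, v i ^ 2 := by
  have h := hA.eigenvectorBasis.sum_sq_inner_left (WithLp.toLp 2 v)
  rw [EuclideanSpace.real_norm_sq_eq] at h
  rw [← h]
  refine Finset.sum_congr rfl fun i _ ↦ ?_
  rw [EuclideanSpace.inner_eq_star_dotProduct, dotProduct_comm]
  simp

lemma sum_eigenvalues_sq (hA : A.IsHermitian) : ∑ i, hA.eigenvalues i ^ 2 = ∑ i, ∑ j, A i j ^ 2 := by
  have h (i : n) : hA.eigenvalues i ^ 2 = ∑ k, (A k ⬝ᵥ (hA.eigenvectorBasis i).ofLp) ^ 2 := by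
    have hi : ∀ k, A k ⬝ᵥ (hA.eigenvectorBasis i).ofLp =
        hA.eigenvalues i * (hA.eigenvectorBasis i).ofLp k := fun k ↦
      congrFun (hA.mulVec_eigenvectorBasis i) k
    have hn := hA.eigenvectorBasis_dotProduct i i
    simp only [dotProduct, if_true] at hn
    simp_rw [hi, mul_pow, ← Finset.mul_sum, sq ((hA.eigenvectorBasis i).ofLp _), hn, mul_one]
  simp_rw [h]
  rw [Finset.sum_comm]
  simp_rw [hA.sum_dotProduct_eigenvectorBasis_sq]

lemma quadratic_sum_smul_eigenvectorBasis (hA : A.IsHermitian) (a x : n → ℝ) :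
    (∑ i, x i • (hA.eigenvectorBasis i).ofLp) ⬝ᵥ
        A *ᵥ (∑ i, x i • (hA.eigenvectorBasis i).ofLp) +
      a ⬝ᵥ (∑ i, x i • (hA.eigenvectorBasis i).ofLp) =
    ∑ i, (hA.eigenvalues i * x i ^ 2 + (a ⬝ᵥ (hA.eigenvectorBasis i).ofLp) * x i) := by
  simp only [mulVec_sum, mulVec_smul, hA.mulVec_eigenvectorBasis, sum_dotProduct, dotProduct_sum,
    smul_dotProduct, dotProduct_smul, hA.eigenvectorBasis_dotProduct, Finset.sum_add_distrib]
  simp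
  congr 1
  · exact Finset.sum_congr rfl fun i _ ↦ by ring
  · exact Finset.sum_congr rfl fun i _ ↦ by ring

/-- The second moment of a quadratic polynomial in independent standard Gaussian variables. -/
lemma integral_sq_quadratic_pi_stdGaussianReal (hA : A.IsHermitian)
    (a : n → ℝ) :
    ∫ ξ : n → ℝ, (ξ ⬝ᵥ A.mulVec ξ + a ⬝ᵥ ξ) ^ 2 ∂(Measure.pi fun _ ↦ gaussianReal 0 1) =
      A.trace ^ 2 + 2 * (∑ i, ∑ j, A i j ^ 2) + ∑ i, a i ^ 2 := by
  have hmeas : Measurable fun ξ : n → ℝ ↦ (ξ ⬝ᵥ A.mulVec ξ + a ⬝ᵥ ξ) ^ 2 := by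
    simp only [mulVec, dotProduct]
    fun_prop
  rw [integral_pi_stdGaussianReal_comp_orthonormalBasis hA.eigenvectorBasis hmeas]
  simp_rw [hA.quadratic_sum_smul_eigenvectorBasis]
  rw [integral_sq_sum_quadratic_pi_stdGaussianReal, Finset.sum_add_distrib, ← Finset.mul_sum,
    hA.sum_eigenvalues_sq, hA.sum_dotProduct_eigenvectorBasis_sq, hA.trace_eq_sum_eigenvalues]
  simp only [RCLike.ofReal_real_eq_id, id]
  ring

lemma iSup_eigenvalues_le_sqrt_sum_sq (hA : A.IsHermitian) :
    ⨆ i, hA.eigenvalues i ≤ Real.sqrt (∑ i, ∑ j, A i j ^ 2) := by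
  refine Real.iSup_le (fun i ↦ Real.le_sqrt_of_sq_le ?_) (Real.sqrt_nonneg _)
  rw [← hA.sum_eigenvalues_sq]
  exact Finset.single_le_sum (f := fun i ↦ hA.eigenvalues i ^ 2) (fun j _ ↦ sq_nonneg _)
    (Finset.mem_univ i)

end Matrix.IsHermitian

/-- The paper's Theorem 2 stated probabilistically: with `ξ ~ N(0,1)^{⊗m}` and
`Q(ξ) = ξᵀAξ + aᵀξ`, for `ρ ∈ (exp(-8), 0.00045)`, any `t` feasible for the moment
inequality-based safe approximation `t ≥ (1/√ρ) (E[Q(ξ)²])^{1/2}` is also feasible for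
the Bernstein-type inequality-based safe approximation
`t ≥ tr A + 2√(ln(1/ρ)) √(‖A‖_F² + ½‖a‖₂²) + 2 ln(1/ρ) s⁺(A)`. -/
theorem stmt_14 (ρ : ℝ) (hρ : ρ ∈ Set.Ioo (Real.exp (-8)) 0.00045) (m : ℕ)
    (A : Matrix (Fin m) (Fin m) ℝ) (hA : A.IsHermitian) (a : Fin m → ℝ)
    (t : ℝ)
    (ht : (1 / Real.sqrt ρ) *
        (∫ ξ : Fin m → ℝ, (ξ ⬝ᵥ A.mulVec ξ + a ⬝ᵥ ξ) ^ 2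
          ∂(Measure.pi fun _ : Fin m => gaussianReal 0 1)) ^ ((1 : ℝ) / 2) ≤ t) :
    Matrix.trace A +
      2 * Real.sqrt (Real.log (1 / ρ)) *
        Real.sqrt ((∑ i, ∑ j, (A i j) ^ 2) + (1 / 2) * ∑ i, (a i) ^ 2) +
      2 * Real.log (1 / ρ) * max (⨆ i, hA.eigenvalues i) 0 ≤ t := by
  obtain ⟨hρ₁, hρ₂⟩ := hρ
  have hρ₀ : 0 < ρ := (Real.exp_pos _).trans hρ₁
  have hlog : Real.log (1 / ρ) ≤ 8 := by
    rw [one_div, Real.log_inv]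
    linarith [(Real.lt_log_iff_exp_lt hρ₀).mpr hρ₁]
  have hsqrtlog : Real.sqrt (Real.log (1 / ρ)) ≤ 3 :=
    Real.sqrt_le_iff.mpr ⟨by norm_num, by linarith⟩
  have hfactor : 16 ≤ 1 / Real.sqrt ρ := by
    rw [le_div_iff₀ (Real.sqrt_pos.mpr hρ₀)]
    have : Real.sqrt ρ ≤ 1 / 16 :=
      Real.sqrt_le_iff.mpr ⟨by norm_num, by norm_num at hρ₂ ⊢; linarith⟩
    linarith
  rw [← Real.sqrt_eq_rpow, hA.integral_sq_quadratic_pi_stdGaussianReal] at ht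
  refine le_trans ?_ ht
  have ha : 0 ≤ ∑ i, a i ^ 2 := Finset.sum_nonneg fun i _ ↦ sq_nonneg _
  have hF : 0 ≤ ∑ i, ∑ j, A i j ^ 2 :=
    Finset.sum_nonneg fun i _ ↦ Finset.sum_nonneg fun j _ ↦ sq_nonneg _
  set F := Real.sqrt ((∑ i, ∑ j, A i j ^ 2) + 1 / 2 * ∑ i, a i ^ 2) with hFdef
  have hF₀ : 0 ≤ F := Real.sqrt_nonneg _
  have hFsq : F ^ 2 = (∑ i, ∑ j, A i j ^ 2) + 1 / 2 * ∑ i, a i ^ 2 :=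
    Real.sq_sqrt (by linarith)
  have hs : max (⨆ i, hA.eigenvalues i) 0 ≤ F :=
    max_le (hA.iSup_eigenvalues_le_sqrt_sum_sq.trans (Real.sqrt_le_sqrt (by linarith))) hF₀
  have hs₀ : 0 ≤ max (⨆ i, hA.eigenvalues i) 0 := le_max_right _ _
  have hmoment : A.trace ^ 2 + 2 * (∑ i, ∑ j, A i j ^ 2) + ∑ i, a i ^ 2 =
      A.trace ^ 2 + 2 * F ^ 2 := by
    rw [hFsq]; ring
  rw [hmoment]
  calc A.trace + 2 * Real.sqrt (Real.log (1 / ρ)) * F +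
        2 * Real.log (1 / ρ) * max (⨆ i, hA.eigenvalues i) 0
      ≤ A.trace + 2 * 3 * F + 2 * 8 * F := by gcongr
    _ ≤ 16 * Real.sqrt (A.trace ^ 2 + 2 * F ^ 2) := by
        rw [← div_le_iff₀' (by norm_num)]
        refine Real.le_sqrt_of_sq_le ?_
        nlinarith [sq_nonneg (11 * A.trace - F), sq_nonneg A.trace, sq_nonneg F]
    _ ≤ 1 / Real.sqrt ρ * Real.sqrt (A.trace ^ 2 + 2 * F ^ 2) := by gcongr
end
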